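/- Let c, m be positive integers, σ: ℝ^c → ℝ^c the softmax function, θ ∈ ℝ^{c×m} a linear model producing logits z(x) = θx, and x_i, x_j ∈ ℝ^m two inputs with labels y_i, y_j ∈ ℝ^c each summing to 1. Let λ ∈ ℝ and define the mixed sample x̃ = λ x_i + (1 − λ) x_j, ỹ = λ y_i + (1 − λ) y_j. Write p = σ(θ x_i), q = σ(θ x_j), and ŷ_{ij} = σ(θ x̃). Then: (1) ŷ_{ij,k} = p_k^λ q_k^{1−λ} / ∑_{n=1}^c p_n^λ q_n^{1−λ} for every k; and (2) the gradient of the cross-entropy loss L(w) = −∑_i ỹ_i log σ(w x̃)_i at w = θ, taken entrywise, satisfies ∂L/∂w_{kn} = (λ (ŷ_{ij} − y_i) + (1 − λ)(ŷ_{ij} − y_j))_k · x̃_n; i.e., the mixed-sample gradient equals (λ(ŷ_{ij} − y_i) + (1 − λ)(ŷ_{ij} − y_j)) x̃ᵀ. -/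

import Mathlib

/-- The softmax function on `ℝ^c`. -/
noncomputable def softmax {c : ℕ} (z : Fin c → ℝ) (i : Fin c) : ℝ :=
  Real.exp (z i) / ∑ n : Fin c, Real.exp (z n)

theorem sum_exp_pos {c : ℕ} (z : Fin c → ℝ) (i : Fin c) :
    0 < ∑ n : Fin c, Real.exp (z n) :=
  Finset.sum_pos (fun n _ => Real.exp_pos (z n)) ⟨i, Finset.mem_univ i⟩

theorem log_softmax {c : ℕ} (z : Fin c → ℝ) (i : Fin c) :
    Real.log (softmax z i) = z i - Real.log (∑ n : Fin c, Real.exp (z n)) := by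
  rw [softmax, Real.log_div (Real.exp_ne_zero _) (sum_exp_pos z i).ne', Real.log_exp]

theorem softmax_rpow {c : ℕ} (z : Fin c → ℝ) (i : Fin c) (a : ℝ) :
    softmax z i ^ a = Real.exp (a * z i) / (∑ n : Fin c, Real.exp (z n)) ^ a := by
  rw [softmax, Real.div_rpow (Real.exp_pos _).le (sum_exp_pos z i).le, ← Real.exp_mul,
    mul_comm]

/-- The softmax of a linear combination of logits is the normalized product of powers. -/
theorem softmax_linear_combination {c : ℕ} (z w : Fin c → ℝ) (a b : ℝ) (k : Fin c) :
    softmax (fun i => a * z i + b * w i) k =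
      softmax z k ^ a * softmax w k ^ b / ∑ n : Fin c, softmax z n ^ a * softmax w n ^ b := by
  have hz := Real.rpow_pos_of_pos (sum_exp_pos z k) a
  have hw := Real.rpow_pos_of_pos (sum_exp_pos w k) b
  simp only [softmax_rpow, div_mul_div_comm, ← Real.exp_add, ← Finset.sum_div]
  rw [div_div_div_cancel_right₀ (mul_pos hz hw).ne', softmax]

/-- Chain rule for the cross-entropy of the softmax of differentiable logits. -/
theorem hasDerivAt_crossEntropy_softmax {c : ℕ} (y : Fin c → ℝ) (hy : ∑ i, y i = 1)
    {z : ℝ → Fin c → ℝ} {z' : Fin c → ℝ} {t : ℝ}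
    (hz : ∀ i, HasDerivAt (fun s => z s i) (z' i) t) :
    HasDerivAt (fun s => -∑ i, y i * Real.log (softmax (z s) i))
      (∑ i, (softmax (z t) i - y i) * z' i) t := by
  have hc : Nonempty (Fin c) := by
    by_contra h
    rw [not_nonempty_iff] at h
    simp at hy
  obtain ⟨i₀⟩ := hc
  have hlog := (HasDerivAt.fun_sum (u := Finset.univ) fun i _ => (hz i).exp).log
    (sum_exp_pos (z t) i₀).ne'
  have hsplit : (fun s => -∑ i, y i * Real.log (softmax (z s) i)) =
      fun s => Real.log (∑ n, Real.exp (z s n)) - ∑ i, y i * z s i := by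
    funext s
    simp only [log_softmax, mul_sub, Finset.sum_sub_distrib, ← Finset.sum_mul, hy]
    ring
  rw [hsplit]
  refine (hlog.fun_sub (HasDerivAt.fun_sum (u := Finset.univ) fun i _ =>
    (hz i).const_mul (y i))).congr_deriv ?_
  simp only [sub_mul, Finset.sum_sub_distrib, softmax, Finset.sum_div, div_mul_eq_mul_div]

theorem hasDerivAt_linear_logit {c m : ℕ} (θ : Fin c → Fin m → ℝ) (x : Fin m → ℝ)
    (k : Fin c) (n₀ : Fin m) (i : Fin c) (t : ℝ) :
    HasDerivAt
      (fun s => ∑ n, Function.update θ k (Function.update (θ k) n₀ s) i n * x n)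
      (if i = k then x n₀ else 0) t := by
  by_cases hik : i = k
  · subst hik
    have hterm : ∀ n, HasDerivAt (fun s => Function.update (θ i) n₀ s n * x n)
        (if n = n₀ then x n else 0) t := by
      intro n
      by_cases hn : n = n₀
      · subst hn
        simpa using (hasDerivAt_id t).mul_const (x n)
      · simpa [hn] using hasDerivAt_const t (θ i n * x n)
    simpa using HasDerivAt.fun_sum (u := Finset.univ) fun n _ => hterm n
  · simpa [hik] using hasDerivAt_const t (∑ n, θ i n * x n)

/-- The paper's Theorem on the gradient of mixed samples under a linear model:
(1) the prediction on the mixed input is the normalized componentwise weighted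
geometric mean of the predictions `p`, `q` on the original inputs; and
(2) the entrywise gradient of the cross-entropy loss of the mixed sample at `θ`
equals `(λ(ŷ - yᵢ) + (1-λ)(ŷ - yⱼ))_k · x̃_n`. -/
theorem mixed_sample_gradient (c m : ℕ) (hc : 0 < c) (hm : 0 < m)
    (θ : Fin c → Fin m → ℝ) (xi xj : Fin m → ℝ) (yi yj : Fin c → ℝ)
    (hyi : ∑ i : Fin c, yi i = 1) (hyj : ∑ i : Fin c, yj i = 1) (lam : ℝ) :
    let xt : Fin m → ℝ := fun n => lam * xi n + (1 - lam) * xj n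
    let yt : Fin c → ℝ := fun i => lam * yi i + (1 - lam) * yj i
    let p : Fin c → ℝ := softmax (fun k => ∑ n : Fin m, θ k n * xi n)
    let q : Fin c → ℝ := softmax (fun k => ∑ n : Fin m, θ k n * xj n)
    let yhat : Fin c → ℝ := softmax (fun k => ∑ n : Fin m, θ k n * xt n)
    (∀ k : Fin c,
      yhat k = p k ^ lam * q k ^ (1 - lam) / ∑ n : Fin c, p n ^ lam * q n ^ (1 - lam)) ∧
    (∀ (k : Fin c) (n0 : Fin m),
      HasDerivAt
        (fun t : ℝ =>
          -∑ i : Fin c, yt i *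
            Real.log (softmax
              (fun k' => ∑ n : Fin m,
                Function.update θ k (Function.update (θ k) n0 t) k' n * xt n) i))
        ((lam * (yhat k - yi k) + (1 - lam) * (yhat k - yj k)) * xt n0)
        (θ k n0)) := by
  intro xt yt p q yhat
  refine ⟨fun k => ?_, fun k n0 => ?_⟩
  · have hlogits : (fun k => ∑ n, θ k n * xt n) =
        fun k => lam * (∑ n, θ k n * xi n) + (1 - lam) * ∑ n, θ k n * xj n := by
      funext k
      simp only [xt, Finset.mul_sum, ← Finset.sum_add_distrib]
      exact Finset.sum_congr rfl fun n _ => by ring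
    simp only [yhat, hlogits]
    exact softmax_linear_combination _ _ lam (1 - lam) k
  · have hyt : ∑ i, yt i = 1 := by
      simp only [yt, Finset.sum_add_distrib, ← Finset.mul_sum, hyi, hyj]
      ring
    convert hasDerivAt_crossEntropy_softmax yt hyt
      (fun i => hasDerivAt_linear_logit θ xt k n0 i (θ k n0)) using 1
    simp only [Function.update_eq_self, mul_ite, mul_zero, Finset.sum_ite_eq',
      Finset.mem_univ, if_true, yhat, yt]
    ring
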